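/- arXiv:2006.07749 — 2 statements merged into one kernel-verified Lean document; each statement's English description precedes it below -/
import Mathlib

section
/- (Parametric bootstrap consistency.) Let {P_θ : θ ∈ Θ ⊆ ℝ^d} be a parametric family and let (θ̂_n, τ̂_n) be (possibly randomized) estimators computed from an i.i.d. sample x_{1:n} ~ P_θ. Let H_n(θ') denote the law of √n(τ̂_n − τ(θ')) when the sample is drawn i.i.d. from P_{θ'}; the parametric bootstrap replicate τ̂*_n is computed by the same procedure from a sample x*_{1:n} drawn i.i.d. from P_{θ̂_n}, so that the conditional law of √n(τ̂*_n − τ̂_n) given θ̂_n = θ' is H_n(θ'). Assume: (i) √n(θ̂_n − θ) converges in distribution under P_θ (in particular is bounded in probability); (ii) the estimator is asymptotically equivariant at θ: for every convergent real sequence h_n, H_n(θ + h_n/√n) converges weakly to a limit law H(θ) whose CDF F_θ is continuous. Then for every t ∈ ℝ, the conditional probability P*_n(√n(τ̂*_n − τ̂_n) ≤ t | θ̂_n) converges to F_θ(t) in P_θ-probability, i.e., the parametric bootstrap estimator is consistent. -/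
open MeasureTheory ProbabilityTheory Filter Topology

noncomputable section

variable {α Ξ : Type*} [MeasurableSpace α] [MeasurableSpace Ξ] {d : ℕ}

/-- The distribution of a (possibly randomized) estimation procedure's input when the data
`x_{1:n}` is drawn i.i.d. from `P θ'` and the auxiliary randomness from `Pξ`. -/
def sampleMeasure (P : (Fin d → ℝ) → Measure α) (Pξ : Measure Ξ)
    (θ' : Fin d → ℝ) (n : ℕ) : Measure ((Fin n → α) × Ξ) :=
  (Measure.pi fun _ : Fin n => P θ').prod Pξ

/-- `H_n(θ')`: the law of the pivot `√n (τ̂_n - τ(θ'))` when the sample is drawn i.i.d.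
from `P θ'`.  By construction of the parametric bootstrap (the replicate `τ̂*_n` is
computed by the same procedure from a fresh i.i.d. sample from `P (θ̂_n)`), the
conditional law of `√n (τ̂*_n - τ̂_n)` given `θ̂_n = θ'` is exactly `H_n(θ')`. -/
def pivotLaw (P : (Fin d → ℝ) → Measure α) (Pξ : Measure Ξ)
    (τhat : ∀ n : ℕ, (Fin n → α) × Ξ → ℝ) (τ : (Fin d → ℝ) → ℝ)
    (n : ℕ) (θ' : Fin d → ℝ) : Measure ℝ :=
  Measure.map (fun s => Real.sqrt n * (τhat n s - τ θ')) (sampleMeasure P Pξ θ' n)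

theorem pbc_unif {E : Type*} [NormedAddCommGroup E] [ProperSpace E] (g : ℕ → E → ℝ) (c : ℝ)
    (hg : ∀ h : ℕ → E, (∃ L, Tendsto h atTop (𝓝 L)) → Tendsto (fun n => g n (h n)) atTop (𝓝 c))
    (M ε : ℝ) (hε : 0 < ε) :
    ∀ᶠ n in atTop, ∀ x : E, ‖x‖ ≤ M → |g n x - c| < ε := by
  by_contra hcon
  rw [not_eventually] at hcon
  obtain ⟨φ, hφ, hbad⟩ := extraction_of_frequently_atTop hcon
  push Not at hbad
  choose x hxM hx using hbad
  obtain ⟨L, -, ψ, hψ, hL⟩ := (isCompact_closedBall (0 : E) M).tendsto_subseq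
    (x := x) (fun n => by simpa using hxM n)
  have hinj : Function.Injective (φ ∘ ψ) := (hφ.comp hψ).injective
  have hlim : Tendsto (Function.extend (φ ∘ ψ) (x ∘ ψ) (fun _ => L)) atTop (𝓝 L) := by
    rw [Metric.tendsto_atTop] at hL ⊢
    intro e he
    obtain ⟨K, hK⟩ := hL e he
    refine ⟨φ (ψ K), fun n hn => ?_⟩
    by_cases hr : ∃ k, (φ ∘ ψ) k = n
    · obtain ⟨k, rfl⟩ := hr
      rw [hinj.extend_apply]
      exact hK k ((hφ.comp hψ).le_iff_le.mp hn)
    · rw [Function.extend_apply' _ _ _ hr]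
      simpa using he
  have h1 := (hg _ ⟨L, hlim⟩).comp (hφ.comp hψ).tendsto_atTop
  rw [Metric.tendsto_atTop] at h1
  obtain ⟨N, hN⟩ := h1 ε hε
  have h2 := hN N le_rfl
  have h3 := hinj.extend_apply (x ∘ ψ) (fun _ => L) N
  simp only [Function.comp_apply, Real.dist_eq] at h2 h3
  have h4 : Function.extend (φ ∘ ψ) (x ∘ ψ) (fun _ => L) (φ (ψ N)) = x (ψ N) := h3
  rw [h4] at h2
  exact absurd (hx (ψ N)) (not_le.mpr h2)

theorem pbc_atom (H : Measure ℝ) [IsProbabilityMeasure H]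
    (hF : Continuous fun t : ℝ => (H (Set.Iic t)).toReal) (t : ℝ) : H {t} = 0 := by
  have hF' : Continuous (cdf H) := by
    have : (fun t : ℝ => (H (Set.Iic t)).toReal) = cdf H := by
      ext s
      rw [cdf_eq_real]; rfl
    rwa [this] at hF
  rw [← measure_cdf H, StieltjesFunction.measure_singleton,
    hF'.continuousAt.continuousWithinAt.leftLim_eq]
  simp

theorem pbc_cdf (ν : ℕ → Measure ℝ) (hν : ∀ n, IsProbabilityMeasure (ν n))
    (H : Measure ℝ) [IsProbabilityMeasure H]
    (hF : Continuous fun t : ℝ => (H (Set.Iic t)).toReal)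
    (hw : ∀ f : BoundedContinuousFunction ℝ ℝ,
      Tendsto (fun n => ∫ y, f y ∂(ν n)) atTop (𝓝 (∫ y, f y ∂H))) (t : ℝ) :
    Tendsto (fun n => (ν n (Set.Iic t)).toReal) atTop (𝓝 (H (Set.Iic t)).toReal) := by
  let ν' : ℕ → ProbabilityMeasure ℝ := fun n => ⟨ν n, hν n⟩
  let H' : ProbabilityMeasure ℝ := ⟨H, inferInstance⟩
  have h1 : Tendsto ν' atTop (𝓝 H') :=
    ProbabilityMeasure.tendsto_iff_forall_integral_tendsto.mpr hw
  have h2 := ProbabilityMeasure.tendsto_measure_of_null_frontier_of_tendsto' h1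
    (E := Set.Iic t) (by rw [frontier_Iic]; exact pbc_atom H hF t)
  exact (ENNReal.tendsto_toReal (measure_ne_top H _)).comp h2

def pbcCut (E : Type*) [NormedAddCommGroup E] (M : ℝ) : BoundedContinuousFunction E ℝ :=
  BoundedContinuousFunction.ofNormedAddCommGroup (fun x : E => min 1 (max 0 (‖x‖ - M)))
    (by fun_prop) 1 (fun x => by
      rw [Real.norm_eq_abs, abs_of_nonneg (by positivity)]
      exact min_le_left _ _)

theorem pbcCut_apply (E : Type*) [NormedAddCommGroup E] (M : ℝ) (x : E) :
    pbcCut E M x = min 1 (max 0 (‖x‖ - M)) := rfl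

theorem pbc_tight {E : Type*} [NormedAddCommGroup E] [MeasurableSpace E] [BorelSpace E]
    {S : ℕ → Type*} [∀ n, MeasurableSpace (S n)] (μ : ∀ n, Measure (S n))
    (hμ : ∀ n, IsProbabilityMeasure (μ n)) (Z : ∀ n, S n → E) (hZ : ∀ n, Measurable (Z n))
    (J : Measure E) [IsProbabilityMeasure J]
    (hw : ∀ f : BoundedContinuousFunction E ℝ,
      Tendsto (fun n => ∫ s, f (Z n s) ∂(μ n)) atTop (𝓝 (∫ x, f x ∂J)))
    (δ : ℝ) (hδ : 0 < δ) :
    ∃ M : ℝ, ∀ᶠ n in atTop, μ n {s | M < ‖Z n s‖} ≤ ENNReal.ofReal δ := by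
  have h1 : Tendsto (fun M : ℕ => ∫ x, pbcCut E M x ∂J) atTop (𝓝 (∫ _, (0 : ℝ) ∂J)) := by
    refine tendsto_integral_of_dominated_convergence (fun _ => (1 : ℝ)) ?_ ?_ ?_ ?_
    · intro n
      exact (pbcCut E n).continuous.measurable.aestronglyMeasurable
    · exact integrable_const _
    · intro n
      refine Eventually.of_forall fun x => ?_
      rw [pbcCut_apply, Real.norm_eq_abs, abs_of_nonneg (by positivity)]
      exact min_le_left _ _
    · refine Eventually.of_forall fun x => ?_
      refine tendsto_const_nhds.congr' ?_
      filter_upwards [eventually_ge_atTop ⌈‖x‖⌉₊] with n hn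
      have : ‖x‖ ≤ n := (Nat.le_ceil _).trans (by exact_mod_cast hn)
      rw [pbcCut_apply, max_eq_left (by linarith)]
      simp
  rw [integral_zero] at h1
  obtain ⟨M, hM⟩ := (h1.eventually (gt_mem_nhds hδ)).exists
  refine ⟨M + 1, ?_⟩
  filter_upwards [(hw (pbcCut E M)).eventually (gt_mem_nhds hM)] with n hn
  have := hμ n
  have hmeas : Measurable fun s => pbcCut E M (Z n s) :=
    (pbcCut E M).continuous.measurable.comp (hZ n)
  have hnn : ∀ s, 0 ≤ pbcCut E M (Z n s) := fun s => by
    rw [pbcCut_apply]; positivity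
  have hint : Integrable (fun s => pbcCut E M (Z n s)) (μ n) := by
    refine Integrable.of_bound hmeas.aestronglyMeasurable 1 (Eventually.of_forall fun s => ?_)
    rw [Real.norm_eq_abs, abs_of_nonneg (hnn s), pbcCut_apply]
    exact min_le_left _ _
  have h2 := mul_meas_ge_le_integral_of_nonneg (Eventually.of_forall hnn) hint 1
  rw [one_mul] at h2
  have h3 : μ n {s | (M : ℝ) + 1 < ‖Z n s‖} ≤ μ n {s | 1 ≤ pbcCut E M (Z n s)} := by
    refine measure_mono fun s hs => ?_
    simp only [Set.mem_ofPred_eq] at hs ⊢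
    rw [pbcCut_apply]
    exact le_min le_rfl (le_max_of_le_right (by linarith))
  refine h3.trans ?_
  rw [← ENNReal.ofReal_toReal (measure_ne_top (μ n) {s | 1 ≤ pbcCut E M (Z n s)})]
  exact ENNReal.ofReal_le_ofReal (h2.trans hn.le)

/-- **Parametric bootstrap consistency** (after Beran 1997).
Let `{P_θ}` be a parametric family, `(θ̂_n, τ̂_n)` possibly randomized estimators computed
from an i.i.d. sample from `P θ`, and let `H_n(θ')` be the law of `√n (τ̂_n - τ(θ'))` under
sampling from `P θ'`, so that the conditional law of the bootstrapped pivot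
`√n (τ̂*_n - τ̂_n)` given `θ̂_n = θ'` is `H_n(θ')`.  Assume
(i) `√n (θ̂_n - θ)` converges in distribution (to some law `J`) under `P_θ`; and
(ii) asymptotic equivariance: for every convergent sequence `h_n`,
`H_n(θ + h_n/√n)` converges weakly to a limit law `Hlim` with continuous CDF `F`.
Then for every `t`, the conditional bootstrap probability
`P*_n(√n (τ̂*_n - τ̂_n) ≤ t | θ̂_n) = H_n(θ̂_n)((-∞, t])` converges to `F t` in
`P_θ`-probability. -/
theorem parametric_bootstrap_consistency
    (P : (Fin d → ℝ) → Measure α) (hP : ∀ θ', IsProbabilityMeasure (P θ'))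
    (Pξ : Measure Ξ) [IsProbabilityMeasure Pξ]
    (θ : Fin d → ℝ)   -- the true parameter
    (θhat : ∀ n : ℕ, (Fin n → α) × Ξ → (Fin d → ℝ))
    (τhat : ∀ n : ℕ, (Fin n → α) × Ξ → ℝ)
    (hθmeas : ∀ n, Measurable (θhat n)) (hτmeas : ∀ n, Measurable (τhat n))
    (τ : (Fin d → ℝ) → ℝ)
    -- (i) √n (θ̂_n - θ) converges in distribution under P_θ
    (J : Measure (Fin d → ℝ)) [IsProbabilityMeasure J]
    (hθconv : ∀ f : BoundedContinuousFunction (Fin d → ℝ) ℝ,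
      Tendsto (fun n => ∫ s, f (Real.sqrt n • (θhat n s - θ)) ∂(sampleMeasure P Pξ θ n))
        atTop (𝓝 (∫ x, f x ∂J)))
    -- (ii) asymptotic equivariance with continuous limiting CDF
    (Hlim : Measure ℝ) [IsProbabilityMeasure Hlim]
    (hFcont : Continuous fun t : ℝ => (Hlim (Set.Iic t)).toReal)
    (hequiv : ∀ h : ℕ → (Fin d → ℝ), (∃ L, Tendsto h atTop (𝓝 L)) →
      ∀ f : BoundedContinuousFunction ℝ ℝ,
        Tendsto (fun n => ∫ y, f y ∂(pivotLaw P Pξ τhat τ n (θ + (Real.sqrt n)⁻¹ • h n)))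
          atTop (𝓝 (∫ y, f y ∂Hlim))) :
    -- conclusion: bootstrap consistency
    ∀ t : ℝ, ∀ ε : ℝ, 0 < ε →
      Tendsto (fun n => (sampleMeasure P Pξ θ n)
          {s | ε ≤ |((pivotLaw P Pξ τhat τ n (θhat n s)) (Set.Iic t)).toReal -
                (Hlim (Set.Iic t)).toReal|})
        atTop (𝓝 0) := by
  intro t ε hε
  have hS : ∀ θ' n, IsProbabilityMeasure (sampleMeasure P Pξ θ' n) := by
    intro θ' n
    have := hP θ'
    unfold sampleMeasure
    infer_instance
  have hprob : ∀ n θ', IsProbabilityMeasure (pivotLaw P Pξ τhat τ n θ') := by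
    intro n θ'
    have := hS θ' n
    unfold pivotLaw
    exact Measure.isProbabilityMeasure_map
      (((hτmeas n).sub_const _).const_mul _).aemeasurable
  have hg : ∀ h : ℕ → (Fin d → ℝ), (∃ L, Tendsto h atTop (𝓝 L)) →
      Tendsto (fun n => ((pivotLaw P Pξ τhat τ n (θ + (Real.sqrt n)⁻¹ • h n))
        (Set.Iic t)).toReal) atTop (𝓝 (Hlim (Set.Iic t)).toReal) := fun h hh =>
    pbc_cdf _ (fun n => hprob n _) Hlim hFcont (hequiv h hh) t
  have hunif := pbc_unif (fun n x => ((pivotLaw P Pξ τhat τ n (θ + (Real.sqrt n)⁻¹ • x))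
        (Set.Iic t)).toReal) _ hg
  rw [ENNReal.tendsto_nhds_zero]
  intro δ hδ
  obtain ⟨δ', hδ0, hδ'⟩ : ∃ δ' : ℝ, 0 < δ' ∧ ENNReal.ofReal δ' ≤ δ := by
    obtain ⟨r, hr0, hr⟩ := ENNReal.lt_iff_exists_nnreal_btwn.mp hδ
    refine ⟨r, by exact_mod_cast hr0, ?_⟩
    rw [ENNReal.ofReal_coe_nnreal]
    exact hr.le
  obtain ⟨M, hM⟩ := pbc_tight (fun n => sampleMeasure P Pξ θ n) (fun n => hS θ n)
    (fun n s => Real.sqrt n • (θhat n s - θ))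
    (fun n => by have := hθmeas n; fun_prop) J hθconv δ' hδ0
  filter_upwards [hM, hunif M ε hε, eventually_gt_atTop 0] with n hn hu hpos
  refine (measure_mono fun s hs => ?_).trans (hn.trans hδ')
  simp only [Set.mem_ofPred_eq] at hs ⊢
  by_contra hcon
  have h1 := hu _ (not_lt.mp hcon)
  have hne : Real.sqrt n ≠ 0 := (Real.sqrt_pos.mpr (by exact_mod_cast hpos)).ne'
  rw [smul_smul, inv_mul_cancel₀ hne, one_smul, add_sub_cancel] at h1
  exact absurd hs (not_le.mpr h1)
end
end

section
/- Let g_n : ℝ^k → ℝ be a sequence of functions such that g_n(h_n) → 0 for every deterministic sequence (h_n) in ℝ^k that is bounded (O(1)). Then for every sequence of random vectors (ĥ_n) that is bounded in probability (O_P(1)), one has g_n(ĥ_n) → 0 in probability. -/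
open MeasureTheory Filter Topology

/-- A random sequence `f n : Ω → E` is bounded in probability (`O_P(1)`):
for every `δ > 0` there exists `M` such that `P(‖f n‖ > M) < δ` for all `n`. -/
def IsBoundedInProbability {Ω E : Type*} [MeasurableSpace Ω] [SeminormedAddGroup E]
    (μ : Measure Ω) (f : ℕ → Ω → E) : Prop :=
  ∀ δ : ENNReal, 0 < δ → ∃ M : ℝ, ∀ n, μ {ω | M < ‖f n ω‖} < δ

/-- `f n → c` in probability: `P(‖f n - c‖ ≥ ε) → 0` for every `ε > 0`. -/
def TendstoInProbability {Ω E : Type*} [MeasurableSpace Ω] [SeminormedAddGroup E]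
    (μ : Measure Ω) (f : ℕ → Ω → E) (c : E) : Prop :=
  ∀ ε : ℝ, 0 < ε → Tendsto (fun n => μ {ω | ε ≤ ‖f n ω - c‖}) atTop (𝓝 0)

/-- Let `g_n : ℝ^k → ℝ` be a sequence of functions such that `g_n (h_n) → 0` for every
deterministic sequence `(h_n)` which is bounded (`O(1)`).  Then for every sequence of
random vectors `(ĥ_n)` which is bounded in probability (`O_P(1)`), one has
`g_n (ĥ_n) → 0` in probability. -/
theorem tendstoInProbability_of_boundedInProbability {k : ℕ}
    {Ω : Type*} [MeasurableSpace Ω] (μ : Measure Ω) [IsProbabilityMeasure μ]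
    (g : ℕ → (Fin k → ℝ) → ℝ)
    (hg : ∀ hs : ℕ → (Fin k → ℝ), (∃ C : ℝ, ∀ n, ‖hs n‖ ≤ C) →
      Tendsto (fun n => g n (hs n)) atTop (𝓝 0))
    (hhat : ℕ → Ω → (Fin k → ℝ))
    (hOP : IsBoundedInProbability μ hhat) :
    TendstoInProbability μ (fun n ω => g n (hhat n ω)) 0 := by
  classical
  intro ε hε
  rw [ENNReal.tendsto_nhds_zero]
  intro δ hδ
  obtain ⟨M, hM⟩ := hOP δ hδ
  let hs : ℕ → (Fin k → ℝ) := fun n =>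
    if h : ∃ x : Fin k → ℝ, ‖x‖ ≤ M ∧ ε ≤ ‖g n x‖ then h.choose else 0
  have hb : ∀ n, ‖hs n‖ ≤ max M 0 := by
    intro n
    by_cases h : ∃ x : Fin k → ℝ, ‖x‖ ≤ M ∧ ε ≤ ‖g n x‖
    · simp only [hs, dif_pos h]
      exact h.choose_spec.1.trans (le_max_left _ _)
    · simp only [hs, dif_neg h, norm_zero]
      exact le_max_right _ _
  have ht := (hg hs ⟨_, hb⟩).norm
  rw [norm_zero] at ht
  filter_upwards [ht.eventually (gt_mem_nhds hε)] with n hn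
  refine (measure_mono ?_).trans (hM n).le
  intro ω hω
  simp only [Set.mem_setOf_eq, sub_zero] at hω ⊢
  by_contra hc
  have h : ∃ x : Fin k → ℝ, ‖x‖ ≤ M ∧ ε ≤ ‖g n x‖ := ⟨_, not_lt.mp hc, hω⟩
  simp only [hs, dif_pos h] at hn
  exact absurd h.choose_spec.2 (not_le.mpr hn)
end
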